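/- Let H be a group, n a natural number, and let H = H_0 ≥ H_1 ≥ … ≥ H_n = {1} be a descending chain of subgroups, each H_i normal in H. Let K be a subgroup of H such that ⁅⁅H_i, H_i⁆, K⁆ ≤ H_{i+1} for every i < n. Then the 2n-th derived subgroup of K is trivial; that is, K is solvable of derived length at most 2n. -/

import Mathlib

/-- If the image of `derivedSeries K m` lies in `A`, then two further derived steps bring it
into every subgroup containing `⁅⁅A, A⁆, K⁆`. -/
theorem map_subtype_derivedSeries_add_two_le {G : Type*} [Group G] {K A B : Subgroup G} {m : ℕ}
    (hA : (derivedSeries K m).map K.subtype ≤ A) (hB : ⁅⁅A, A⁆, K⁆ ≤ B) :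
    (derivedSeries K (m + 2)).map K.subtype ≤ B := by
  rw [derivedSeries_succ, Subgroup.map_commutator]
  refine (Subgroup.commutator_mono ?_ (Subgroup.map_subtype_le _)).trans hB
  rw [derivedSeries_succ, Subgroup.map_commutator]
  exact Subgroup.commutator_mono hA hA

/-- **Paper, inductive step inside Lemma Lem_SolSub2n.**
Let `H` be a group, `H = H_0 ≥ H_1 ≥ … ≥ H_n = 1` a descending chain of normal
subgroups of `H`, and `K ≤ H` a subgroup such that `⁅⁅H_i, H_i⁆, K⁆ ≤ H_{i+1}` for
every `i < n`.  Then the `2n`-th derived subgroup of `K` is trivial, i.e. `K` is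
solvable of derived length at most `2n`. -/
theorem derived_length_le_of_chain {H : Type*} [Group H] (n : ℕ)
    (Hs : Fin (n + 1) → Subgroup H)
    (hnorm : ∀ i, (Hs i).Normal)
    (hchain : ∀ i : Fin n, Hs i.succ ≤ Hs i.castSucc)
    (htop : Hs 0 = ⊤) (hbot : Hs (Fin.last n) = ⊥)
    (K : Subgroup H)
    (hcomm : ∀ i : Fin n, ⁅⁅Hs i.castSucc, Hs i.castSucc⁆, K⁆ ≤ Hs i.succ) :
    derivedSeries K (2 * n) = ⊥ := by
  have key (i : Fin (n + 1)) : (derivedSeries K (2 * (i : ℕ))).map K.subtype ≤ Hs i := by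
    induction i using Fin.induction with
    | zero => simp [htop]
    | succ i ih => exact map_subtype_derivedSeries_add_two_le ih (hcomm i)
  have h := key (Fin.last n)
  rw [hbot, le_bot_iff, Fin.val_last] at h
  exact (Subgroup.map_eq_bot_iff_of_injective _ K.subtype_injective).mp h
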